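/- Let 𝒜 be a semi-abelian category and let 0→K→X→Y→0 be a short exact sequence, with kernel k: K→X and regular epimorphism f: X→Y, such that f is a central extension. Let A be an abelian object, and let m: K→A be a normal monomorphism (a kernel of some morphism) admitting a retraction s: A→K (s∘m = 1_K). Then there exists a central extension p: Z→Y with kernel l: A→Z, together with a morphism m̄: X→Z such that p∘m̄ = f and m̄∘k = l∘m. -/

import Mathlib

open CategoryTheory CategoryTheory.Limits

universe v u

section Defs

variable {C : Type u} [Category.{v} C]

/-- A finitely complete category is protomodular if, for every commutative diagram of two
adjacent commutative squares in which the middle vertical morphism is a split epimorphism,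
whenever the left-hand square and the outer rectangle are pullbacks, so is the right-hand
square. -/
def Protomodular (C : Type u) [Category.{v} C] : Prop :=
  ∀ ⦃A B D A' B' D' : C⦄ (f : A ⟶ B) (g : B ⟶ D)
    (f' : A' ⟶ B') (g' : B' ⟶ D')
    (a : A ⟶ A') (b : B ⟶ B') (d : D ⟶ D'),
    g ≫ d = b ≫ g' →
    IsSplitEpi b →
    IsPullback f a b f' →
    IsPullback (f ≫ g) a d (f' ≫ g') →
    IsPullback g b d g'

variable [HasZeroMorphisms C] [HasFiniteLimits C]

/-- Two coterminal morphisms `k`, `k'` cooperate (commute in the sense of Huq) when there is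
a morphism `φ : K ⨯ K' ⟶ X` restricting to `k` and `k'` along `(1,0)` and `(0,1)`. -/
def Cooperate {K K' X : C} (k : K ⟶ X) (k' : K' ⟶ X) : Prop :=
  ∃ φ : K ⨯ K' ⟶ X, prod.lift (𝟙 K) 0 ≫ φ = k ∧ prod.lift 0 (𝟙 K') ≫ φ = k'

/-- A morphism is central in the sense of Huq when it cooperates with the identity. -/
def HuqCentral {K X : C} (k : K ⟶ X) : Prop :=
  Cooperate k (𝟙 X)

/-- An object is abelian when its identity cooperates with itself. -/
def IsAbelianObj (A : C) : Prop :=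
  Cooperate (𝟙 A) (𝟙 A)

/-- `k` is a kernel of `f`. -/
def IsKernelOf {K X Y : C} (k : K ⟶ X) (f : X ⟶ Y) : Prop :=
  ∃ w : k ≫ f = 0, Nonempty (IsLimit (KernelFork.ofι k w))

/-- A central extension is a regular epimorphism whose kernel is Huq-central. -/
def IsCentralExt {X Y : C} (f : X ⟶ Y) : Prop :=
  Nonempty (RegularEpi f) ∧ HuqCentral (kernel.ι f)

/-- A normal monomorphism: a morphism that is a kernel of some morphism. -/
def IsNormalMonoP {K X : C} (m : K ⟶ X) : Prop :=
  ∃ (Z : C) (g : X ⟶ Z), IsKernelOf m g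

/-- `(p₁, p₂) : R ↣ X ⨯ X` is an internal equivalence relation. -/
structure IsEquivRelation {R X : C} (p₁ p₂ : R ⟶ X) : Prop where
  mono : Mono (prod.lift p₁ p₂)
  refl : ∃ d : X ⟶ R, d ≫ p₁ = 𝟙 X ∧ d ≫ p₂ = 𝟙 X
  symm : ∃ s : R ⟶ R, s ≫ p₁ = p₂ ∧ s ≫ p₂ = p₁
  trans : ∃ t : pullback p₂ p₁ ⟶ R,
    t ≫ p₁ = pullback.fst p₂ p₁ ≫ p₁ ∧ t ≫ p₂ = pullback.snd p₂ p₁ ≫ p₂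

end Defs

/-- A semi-abelian category: pointed, Barr-exact (regular with effective equivalence
relations), protomodular and with binary coproducts. -/
class SemiAbelian (C : Type u) [Category.{v} C] [HasZeroMorphisms C] [HasZeroObject C]
    [HasFiniteLimits C] [HasBinaryCoproducts C] : Prop where
  /-- Every kernel pair has a coequalizer. -/
  hasCoeqOfKernelPair : ∀ {X Y : C} (f : X ⟶ Y),
    HasCoequalizer (pullback.fst f f) (pullback.snd f f)
  /-- Regular epimorphisms are stable under pullback. -/
  regEpiPullbackStable : ∀ {X Y Z : C} (f : X ⟶ Z) (g : Y ⟶ Z),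
    Nonempty (RegularEpi g) → Nonempty (RegularEpi (pullback.fst f g))
  /-- Every internal equivalence relation is effective, i.e. a kernel pair. -/
  equivRelationEffective : ∀ {R X : C} (p₁ p₂ : R ⟶ X), IsEquivRelation p₁ p₂ →
    ∃ (Y : C) (f : X ⟶ Y), IsKernelPair f p₁ p₂
  /-- The category is protomodular. -/
  protomodular : Protomodular C

section Helpers

variable {C : Type u} [Category.{v} C]

theorem nonempty_regularEpi_comp_of_section [HasPullbacks C] {W X Y : C} {q : W ⟶ X}
    {i : X ⟶ W} (hi : i ≫ q = 𝟙 X) {f : X ⟶ Y} (hf : RegularEpi f) :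
    Nonempty (RegularEpi (q ≫ f)) := by
  have key : ∀ {T : C} (g : W ⟶ T),
      pullback.fst (q ≫ f) (q ≫ f) ≫ g = pullback.snd (q ≫ f) (q ≫ f) ≫ g →
      ∀ {S : C} (a b : S ⟶ W), a ≫ q ≫ f = b ≫ q ≫ f → a ≫ g = b ≫ g := by
    intro T g hg S a b hab
    have := congrArg (pullback.lift a b hab ≫ ·) hg
    simpa [pullback.lift_fst_assoc, pullback.lift_snd_assoc] using this
  have hg' : ∀ {T : C} (g : W ⟶ T),
      pullback.fst (q ≫ f) (q ≫ f) ≫ g = pullback.snd (q ≫ f) (q ≫ f) ≫ g →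
      hf.left ≫ i ≫ g = hf.right ≫ i ≫ g := by
    intro T g hg
    simpa using key g hg (hf.left ≫ i) (hf.right ≫ i) (by simp [reassoc_of% hi, hf.w])
  have hqi : ∀ {T : C} (g : W ⟶ T),
      pullback.fst (q ≫ f) (q ≫ f) ≫ g = pullback.snd (q ≫ f) (q ≫ f) ≫ g →
      q ≫ i ≫ g = g := by
    intro T g hg
    simpa using key g hg (q ≫ i) (𝟙 W) (by simp [reassoc_of% hi])
  exact ⟨{
    W := pullback (q ≫ f) (q ≫ f)
    left := pullback.fst _ _
    right := pullback.snd _ _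
    w := pullback.condition
    isColimit := Cofork.IsColimit.mk _
      (fun c => Cofork.IsColimit.desc hf.isColimit (i ≫ c.π) (hg' c.π c.condition))
      (fun c => by
        have := Cofork.IsColimit.π_desc' hf.isColimit (i ≫ c.π) (hg' c.π c.condition)
        simp only [Cofork.π_ofπ, Category.assoc] at this ⊢
        rw [this, hqi c.π c.condition])
      (fun c t ht => by
        apply Cofork.IsColimit.hom_ext hf.isColimit
        rw [Cofork.IsColimit.π_desc' hf.isColimit, ← ht]
        simp [reassoc_of% hi]) }⟩

variable [HasZeroMorphisms C]

theorem IsKernelOf.mono {K X Y : C} {k : K ⟶ X} {f : X ⟶ Y} (h : IsKernelOf k f) : Mono k := by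
  obtain ⟨w, ⟨hl⟩⟩ := h
  exact ⟨fun a b hab => Fork.IsLimit.hom_ext hl hab⟩

theorem IsKernelOf.exists_lift {K X Y T : C} {k : K ⟶ X} {f : X ⟶ Y} (h : IsKernelOf k f)
    (t : T ⟶ X) (ht : t ≫ f = 0) : ∃ l : T ⟶ K, l ≫ k = t := by
  obtain ⟨w, ⟨hl⟩⟩ := h
  exact ⟨hl.lift (KernelFork.ofι t ht), hl.fac _ WalkingParallelPair.zero⟩

theorem IsKernelOf.of_exists_lift {K X Y : C} {k : K ⟶ X} {f : X ⟶ Y} [Mono k] (w : k ≫ f = 0)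
    (h : ∀ ⦃T : C⦄ (t : T ⟶ X), t ≫ f = 0 → ∃ l : T ⟶ K, l ≫ k = t) : IsKernelOf k f := by
  choose l hl using h
  exact ⟨w, ⟨KernelFork.IsLimit.ofι k w (fun t ht => l t ht) (fun t ht => hl t ht)
    (fun t ht b hb => by rw [← cancel_mono k, hb, hl])⟩⟩

theorem IsKernelOf.iso_comp {K K' X Y : C} {k : K ⟶ X} {f : X ⟶ Y} (h : IsKernelOf k f)
    (e : K' ⟶ K) [IsIso e] : IsKernelOf (e ≫ k) f := by
  have := h.mono
  refine .of_exists_lift (by rw [Category.assoc, h.1, comp_zero]) fun T t ht => ?_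
  obtain ⟨l, hl⟩ := h.exists_lift t ht
  exact ⟨l ≫ inv e, by simp [hl]⟩

open ZeroObject in
theorem IsKernelOf.isPullback [HasZeroObject C] {K X Y : C} {k : K ⟶ X} {f : X ⟶ Y}
    (h : IsKernelOf k f) : IsPullback k (0 : K ⟶ 0) f (0 : (0 : C) ⟶ Y) := by
  have := h.mono
  refine ⟨⟨by rw [h.1, comp_zero]⟩, ⟨PullbackCone.IsLimit.mk _
    (fun c => (h.exists_lift c.fst (by simpa using c.condition)).choose)
    (fun c => (h.exists_lift c.fst (by simpa using c.condition)).choose_spec)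
    (fun c => (isZero_zero C).eq_of_tgt _ _)
    (fun c t ht _ => ?_)⟩⟩
  rw [← cancel_mono k, ht]
  exact (h.exists_lift c.fst (by simpa using c.condition)).choose_spec.symm

open ZeroObject in
/-- The split short five lemma. -/
theorem Protomodular.isIso_of_isKernelOf [HasZeroObject C] (hC : Protomodular C)
    {N E E' B : C} {n : N ⟶ E}
    {p : E ⟶ B} {p' : E' ⟶ B} {u : E ⟶ E'} (hu : u ≫ p' = p) (hp : IsSplitEpi p)
    (hn : IsKernelOf n p) (hn' : IsKernelOf (n ≫ u) p') : IsIso u := by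
  have := hC n u (0 : (0 : C) ⟶ B) (𝟙 B) (0 : N ⟶ 0) p p' (by simp [hu]) hp hn.isPullback
    (by simpa using hn'.isPullback)
  exact this.isIso_fst_of_isIso

variable [HasFiniteLimits C]

theorem isKernelOf_kernel_ι {X Y : C} (f : X ⟶ Y) : IsKernelOf (kernel.ι f) f :=
  IsKernelOf.of_exists_lift (kernel.condition f) fun _ t ht =>
    ⟨kernel.lift f t ht, kernel.lift_ι f t ht⟩

theorem isKernelOf_prod_snd (A B : C) :
    IsKernelOf (prod.lift (𝟙 A) 0) (prod.snd : A ⨯ B ⟶ B) := by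
  have : Mono (prod.lift (𝟙 A) (0 : A ⟶ B)) := mono_of_mono_fac (prod.lift_fst _ _)
  exact .of_exists_lift (prod.lift_snd _ _) fun T t ht =>
    ⟨t ≫ prod.fst, Limits.prod.hom_ext (by simp [prod.lift_fst]) (by simp [prod.lift_snd, ht])⟩

theorem isKernelOf_prod_fst (A B : C) :
    IsKernelOf (prod.lift 0 (𝟙 B)) (prod.fst : A ⨯ B ⟶ A) := by
  have : Mono (prod.lift (0 : B ⟶ A) (𝟙 B)) := mono_of_mono_fac (prod.lift_snd _ _)
  exact .of_exists_lift (prod.lift_fst _ _) fun T t ht =>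
    ⟨t ≫ prod.snd, Limits.prod.hom_ext (by simp [prod.lift_fst, ht])
      (by rw [Category.assoc, prod.lift_snd, Category.comp_id])⟩

theorem IsKernelOf.prodMap_id {K X Y : C} {k : K ⟶ X} {f : X ⟶ Y} (h : IsKernelOf k f) (Q : C) :
    IsKernelOf (prod.map k (𝟙 Q)) (prod.fst ≫ f) := by
  have := h.mono
  refine .of_exists_lift (by rw [prod.map_fst_assoc, h.1, comp_zero]) fun T t ht => ?_
  obtain ⟨l, hl⟩ := h.exists_lift (t ≫ prod.fst) (by simpa using ht)
  exact ⟨prod.lift l (t ≫ prod.snd), Limits.prod.hom_ext (by simp [prod.lift_fst, hl])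
    (by simp [prod.lift_snd])⟩

theorem HuqCentral.comp {K K' X : C} {k : K ⟶ X} (h : HuqCentral k) (e : K' ⟶ K) :
    HuqCentral (e ≫ k) := by
  obtain ⟨φ, h₁, h₂⟩ := h
  refine ⟨prod.map e (𝟙 X) ≫ φ, ?_, ?_⟩
  · rw [← h₁, ← Category.assoc, ← Category.assoc]
    congr 1
    ext <;> simp
  · conv_rhs => rw [← h₂]
    rw [← Category.assoc]
    congr 1
    ext <;> simp

theorem HuqCentral.prodMap_id {K X : C} {k : K ⟶ X} (h : HuqCentral k) {Q : C}
    (hQ : IsAbelianObj Q) : HuqCentral (prod.map k (𝟙 Q)) := by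
  obtain ⟨φ, h₁, h₂⟩ := h
  obtain ⟨ψ, h₃, h₄⟩ := hQ
  refine ⟨prod.lift (prod.map prod.fst prod.fst ≫ φ) (prod.map prod.snd prod.snd ≫ ψ), ?_, ?_⟩
  · ext
    · rw [Category.assoc, prod.lift_fst, prod.map_fst, ← h₁, ← Category.assoc, ← Category.assoc]
      congr 1
      ext <;> simp
    · rw [Category.assoc, prod.lift_snd, prod.map_snd, ← h₃, ← Category.assoc, ← Category.assoc]
      congr 1
      ext <;> simp
  · ext
    · rw [Category.assoc, prod.lift_fst, Category.id_comp]
      conv_rhs => rw [← Category.comp_id prod.fst, ← h₂]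
      rw [← Category.assoc, ← Category.assoc]
      congr 1
      ext <;> simp
    · rw [Category.assoc, prod.lift_snd, Category.id_comp]
      conv_rhs => rw [← Category.comp_id prod.snd, ← h₄]
      rw [← Category.assoc, ← Category.assoc]
      congr 1
      ext <;> simp

theorem IsCentralExt.of_isKernelOf {K X Y : C} {k : K ⟶ X} {f : X ⟶ Y} (hk : IsKernelOf k f)
    (hf : Nonempty (RegularEpi f)) (h : HuqCentral k) : IsCentralExt f := by
  obtain ⟨e, he⟩ := hk.exists_lift (kernel.ι f) (kernel.condition f)
  exact ⟨hf, he ▸ h.comp e⟩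

theorem IsCentralExt.huqCentral {K X Y : C} {k : K ⟶ X} {f : X ⟶ Y} (hf : IsCentralExt f)
    (hk : IsKernelOf k f) : HuqCentral k := by
  rw [← kernel.lift_ι f k hk.1]
  exact hf.2.comp _

section Protomodular

variable [HasZeroObject C]

theorem Protomodular.prod_hom_ext (hC : Protomodular C) {A B T : C} {u v : A ⨯ B ⟶ T}
    (h₁ : prod.lift (𝟙 A) 0 ≫ u = prod.lift (𝟙 A) 0 ≫ v)
    (h₂ : prod.lift 0 (𝟙 B) ≫ u = prod.lift 0 (𝟙 B) ≫ v) : u = v := by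
  have hK := isKernelOf_prod_snd A B
  have hmono := hK.mono
  have hι : equalizer.lift _ h₁ ≫ equalizer.ι u v = prod.lift (𝟙 A) 0 := equalizer.lift_ι _ h₁
  have hn : Mono (equalizer.lift _ h₁) := mono_of_mono_fac hι
  have : IsIso (equalizer.ι u v) := by
    refine hC.isIso_of_isKernelOf (p' := prod.snd) (n := equalizer.lift _ h₁) rfl
      (IsSplitEpi.mk' ⟨equalizer.lift _ h₂, by rw [equalizer.lift_ι_assoc, prod.lift_snd]⟩) ?_
      (hι.symm ▸ hK)
    refine .of_exists_lift (by rw [equalizer.lift_ι_assoc, prod.lift_snd]) fun T t ht => ?_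
    obtain ⟨l, hl⟩ := hK.exists_lift (t ≫ equalizer.ι u v) (by simpa using ht)
    exact ⟨l, by rw [← cancel_mono (equalizer.ι u v), Category.assoc, hι, hl]⟩
  exact (cancel_epi (equalizer.ι u v)).1 (equalizer.condition u v)

/-- Kernels of abelian objects are abelian. -/
theorem Protomodular.isAbelianObj_of_isKernelOf (hC : Protomodular C) {Q A K : C} {i : Q ⟶ A}
    {s : A ⟶ K} (hi : IsKernelOf i s) (hA : IsAbelianObj A) : IsAbelianObj Q := by
  obtain ⟨φ, h₁, h₂⟩ := hA
  have := hi.mono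
  have e₁ : prod.lift (𝟙 Q) 0 ≫ prod.map i i ≫ φ = i := by
    conv_rhs => rw [← Category.comp_id i, ← h₁]
    rw [← Category.assoc, ← Category.assoc]
    congr 1
    ext <;> simp
  have e₂ : prod.lift 0 (𝟙 Q) ≫ prod.map i i ≫ φ = i := by
    conv_rhs => rw [← Category.comp_id i, ← h₂]
    rw [← Category.assoc, ← Category.assoc]
    congr 1
    ext <;> simp
  obtain ⟨ψ, hψ⟩ := hi.exists_lift (prod.map i i ≫ φ) (by
    apply hC.prod_hom_ext
    · rw [← Category.assoc, e₁, hi.1, comp_zero]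
    · rw [← Category.assoc, e₂, hi.1, comp_zero])
  refine ⟨ψ, ?_, ?_⟩ <;> rw [← cancel_mono i, Category.assoc, hψ, Category.id_comp]
  exacts [e₁, e₂]

/-- A retract of an abelian object is a direct factor of it. -/
theorem Protomodular.exists_iso_prod (hC : Protomodular C) {Q A K : C} {i : Q ⟶ A} {m : K ⟶ A}
    {s : A ⟶ K} (hi : IsKernelOf i s) (hs : m ≫ s = 𝟙 K) (hA : IsAbelianObj A) :
    ∃ ψ : K ⨯ Q ⟶ A, IsIso ψ ∧ prod.lift (𝟙 K) 0 ≫ ψ = m := by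
  obtain ⟨φ, h₁, h₂⟩ := hA
  have e₁ : prod.lift (𝟙 K) 0 ≫ prod.map m i ≫ φ = m := by
    conv_rhs => rw [← Category.comp_id m, ← h₁]
    rw [← Category.assoc, ← Category.assoc]
    congr 1
    ext <;> simp
  have e₂ : prod.lift 0 (𝟙 Q) ≫ prod.map m i ≫ φ = i := by
    conv_rhs => rw [← Category.comp_id i, ← h₂]
    rw [← Category.assoc, ← Category.assoc]
    congr 1
    ext <;> simp
  refine ⟨prod.map m i ≫ φ, ?_, e₁⟩
  refine hC.isIso_of_isKernelOf (p := prod.fst) (p' := s) ?_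
    (IsSplitEpi.mk' ⟨prod.lift (𝟙 K) 0, prod.lift_fst _ _⟩) (isKernelOf_prod_fst K Q)
    (e₂.symm ▸ hi)
  apply hC.prod_hom_ext
  · rw [← Category.assoc, e₁, hs, prod.lift_fst]
  · rw [← Category.assoc, e₂, hi.1, prod.lift_fst]

end Protomodular

end Helpers

/-- Given a central extension `f : X ⟶ Y` with kernel `k : K ⟶ X`, an abelian object `A`
and a split normal monomorphism `m : K ⟶ A`, there is a central extension of `Y` by `A`
making the diagram commutative. -/
theorem statement6 {C : Type u} [Category.{v} C] [HasZeroMorphisms C] [HasZeroObject C]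
    [HasFiniteLimits C] [HasBinaryCoproducts C] [SemiAbelian C]
    {K X Y : C} (k : K ⟶ X) (f : X ⟶ Y)
    (hk : IsKernelOf k f) (hf : IsCentralExt f)
    {A : C} (hA : IsAbelianObj A)
    (m : K ⟶ A) (hm : IsNormalMonoP m)
    (s : A ⟶ K) (hs : m ≫ s = 𝟙 K) :
    ∃ (Z : C) (p : Z ⟶ Y) (l : A ⟶ Z) (mbar : X ⟶ Z),
      IsCentralExt p ∧ IsKernelOf l p ∧ mbar ≫ p = f ∧ k ≫ mbar = m ≫ l := by
  have hC : Protomodular C := SemiAbelian.protomodular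
  have hi := isKernelOf_kernel_ι s
  obtain ⟨ψ, hψ, hψm⟩ := hC.exists_iso_prod hi hs hA
  obtain ⟨⟨hreg⟩, -⟩ := id hf
  have hkl := hk.prodMap_id (kernel s)
  refine ⟨X ⨯ kernel s, prod.fst ≫ f, inv ψ ≫ prod.map k (𝟙 _), prod.lift (𝟙 X) 0,
    .of_isKernelOf hkl (nonempty_regularEpi_comp_of_section (prod.lift_fst (𝟙 X) 0) hreg)
      ((hf.huqCentral hk).prodMap_id (hC.isAbelianObj_of_isKernelOf hi hA)),
    hkl.iso_comp (inv ψ), by rw [prod.lift_fst_assoc, Category.id_comp], ?_⟩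
  simp [← hψm]
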